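/- Let φ : ℝⁿ → ℝ be a smooth strictly convex function whose gradient map ∇φ is a diffeomorphism from ℝⁿ onto the open convex set Δ_φ of subgradients of φ, and let u : Δ_φ → ℝ be a bounded smooth strictly concave function. Let φ*(y) := sup_{x∈ℝⁿ}(⟨x,y⟩ − φ(x)) for y ∈ Δ_φ. For λ ∈ ℝ set A_λ := {y ∈ Δ_φ : u(y) ≥ λ} and φ_λ(x) := sup{ψ(x) : ψ : ℝⁿ → ℝ convex, ψ ≤ φ on ℝⁿ, Δ_ψ ⊆ A_λ} (with φ_λ(x) := −∞ if no such ψ exists, e.g. when A_λ = ∅). Then for every x ∈ ℝⁿ and every t ≥ 0: sup_{y ∈ Δ_φ} (⟨x,y⟩ − φ*(y) + t·u(y)) = sup_{λ ∈ ℝ} (φ_λ(x) + t·λ). In other words, the Legendre transform in x of φ* − t·u coincides with the Legendre transform in λ of the concave curve λ ↦ φ_λ. -/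

import Mathlib

open scoped RealInnerProductSpace

/-- The set of subgradients of a function `ψ : ℝⁿ → ℝ`: those `y` such that
`x ↦ ψ(x) − ⟨x,y⟩` is bounded below. -/
def subgradSet {n : ℕ} (ψ : EuclideanSpace ℝ (Fin n) → ℝ) : Set (EuclideanSpace ℝ (Fin n)) :=
  {y | BddBelow (Set.range fun x => ψ x - ⟪x, y⟫)}

/-- The Legendre transform of `f` at `y`: `sup_x (⟨x,y⟩ − f x)`. -/
noncomputable def legendreTransform {n : ℕ} (f : EuclideanSpace ℝ (Fin n) → ℝ)
    (y : EuclideanSpace ℝ (Fin n)) : ℝ :=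
  ⨆ x : EuclideanSpace ℝ (Fin n), (⟪x, y⟫ - f x)

/-- A finite convex function on `ℝⁿ` has, through every point strictly below its graph, an affine
minorant with gradient in its set of subgradients. -/
theorem ConvexOn.exists_mem_subgradSet {n : ℕ} {ψ : EuclideanSpace ℝ (Fin n) → ℝ}
    (hψ : ConvexOn ℝ Set.univ ψ) (x : EuclideanSpace ℝ (Fin n)) {a : ℝ} (ha : a < ψ x) :
    ∃ y ∈ subgradSet ψ, ∀ z, a + ⟪z, y⟫ - ⟪x, y⟫ ≤ ψ z := by
  obtain ⟨l, c, hle, hx⟩ := hψ.exists_affine_le_of_lt (𝕜 := ℝ) (Set.mem_univ x) ha isClosed_univ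
    (hψ.continuousOn isOpen_univ).lowerSemicontinuousOn
  have hl (z) : ⟪z, (InnerProductSpace.toDual ℝ _).symm l⟫ = l z := by
    rw [real_inner_comm, InnerProductSpace.toDual_symm_apply]
  have hle' (z) : l z + c ≤ ψ z := by simpa using hle ⟨z, Set.mem_univ z⟩
  refine ⟨(InnerProductSpace.toDual ℝ _).symm l, ⟨c, ?_⟩, fun z => ?_⟩
  · rintro _ ⟨z, rfl⟩
    linarith [hl z, hle' z]
  · have hx' : l x + c = a := by simpa using hx
    linarith [hl z, hl x, hle' z]

theorem inner_sub_le_legendreTransform {n : ℕ} {φ : EuclideanSpace ℝ (Fin n) → ℝ}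
    {y : EuclideanSpace ℝ (Fin n)} (hy : y ∈ subgradSet φ) (z : EuclideanSpace ℝ (Fin n)) :
    ⟪z, y⟫ - φ z ≤ legendreTransform φ y := by
  obtain ⟨b, hb⟩ := hy
  refine le_ciSup (f := fun z => ⟪z, y⟫ - φ z) ⟨-b, ?_⟩ z
  rintro _ ⟨w, rfl⟩
  have : b ≤ φ w - ⟪w, y⟫ := hb ⟨w, rfl⟩
  dsimp only
  linarith

theorem subgradSet_inner_sub_const {n : ℕ} (y : EuclideanSpace ℝ (Fin n)) (c : ℝ) :
    subgradSet (fun z => ⟪z, y⟫ - c) ⊆ {y} := by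
  rintro w ⟨b, hb⟩
  by_contra hne
  have hpos : 0 < ⟪w - y, w - y⟫ := real_inner_self_pos.2 (sub_ne_zero.2 hne)
  have h := hb ⟨((|b| + |c| + 1) / ⟪w - y, w - y⟫) • (w - y), rfl⟩
  have h2 : ⟪((|b| + |c| + 1) / ⟪w - y, w - y⟫) • (w - y), w - y⟫ = |b| + |c| + 1 := by
    rw [real_inner_smul_left, div_mul_cancel₀ _ hpos.ne']
  rw [inner_sub_right] at h2
  dsimp only at h
  linarith [neg_abs_le b, neg_abs_le c]

/-- with φ smooth strictly convex whose gradient is a diffeomorphism onto the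
open convex set Δ_φ of subgradients, and u bounded smooth strictly concave on Δ_φ, for every
x and t ≥ 0 the Legendre transform in x of φ* − t·u coincides with the Legendre transform in
λ of the concave curve λ ↦ φ_λ (where φ_λ is the envelope of convex functions ψ ≤ φ with
Δ_ψ ⊆ A_λ = {u ≥ λ}, interpreted as −∞ when no such ψ exists; both suprema are taken as
suprema of sets of real numbers). -/
theorem legendre_in_x_eq_legendre_in_lambda {n : ℕ}
    (φ : EuclideanSpace ℝ (Fin n) → ℝ)
    (hφ : ContDiff ℝ (⊤ : ℕ∞) φ) (hφconv : StrictConvexOn ℝ Set.univ φ)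
    (hΔopen : IsOpen (subgradSet φ)) (hΔconv : Convex ℝ (subgradSet φ))
    -- the gradient of φ is a diffeomorphism from ℝⁿ onto Δ_φ:
    (g : EuclideanSpace ℝ (Fin n) → EuclideanSpace ℝ (Fin n))
    (hbij : Set.BijOn (gradient φ) Set.univ (subgradSet φ))
    (hg : ContDiffOn ℝ (⊤ : ℕ∞) g (subgradSet φ))
    (hgleft : ∀ x, g (gradient φ x) = x)
    (hgright : ∀ y ∈ subgradSet φ, gradient φ (g y) = y)
    -- u is a bounded smooth strictly concave function on Δ_φ:
    (u : EuclideanSpace ℝ (Fin n) → ℝ)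
    (hubdd : BddAbove (u '' subgradSet φ) ∧ BddBelow (u '' subgradSet φ))
    (husmooth : ContDiffOn ℝ (⊤ : ℕ∞) u (subgradSet φ))
    (huconc : StrictConcaveOn ℝ (subgradSet φ) u)
    (x : EuclideanSpace ℝ (Fin n)) (t : ℝ) (ht : 0 ≤ t) :
    sSup {v : ℝ | ∃ y ∈ subgradSet φ, v = ⟪x, y⟫ - legendreTransform φ y + t * u y}
      = sSup {v : ℝ | ∃ lam : ℝ, ∃ ψ : EuclideanSpace ℝ (Fin n) → ℝ,
          ConvexOn ℝ Set.univ ψ ∧ (∀ z, ψ z ≤ φ z) ∧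
          subgradSet ψ ⊆ {y ∈ subgradSet φ | lam ≤ u y} ∧ v = ψ x + t * lam} := by
  set S := {v : ℝ | ∃ y ∈ subgradSet φ, v = ⟪x, y⟫ - legendreTransform φ y + t * u y}
  have hS : BddAbove S := by
    obtain ⟨M, hM⟩ := hubdd.1
    refine ⟨φ x + t * M, ?_⟩
    rintro _ ⟨y, hy, rfl⟩
    linarith [inner_sub_le_legendreTransform hy x,
      mul_le_mul_of_nonneg_left (hM ⟨y, hy, rfl⟩) ht]
  have hle : ∀ v ∈ {v : ℝ | ∃ lam : ℝ, ∃ ψ : EuclideanSpace ℝ (Fin n) → ℝ,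
      ConvexOn ℝ Set.univ ψ ∧ (∀ z, ψ z ≤ φ z) ∧
      subgradSet ψ ⊆ {y ∈ subgradSet φ | lam ≤ u y} ∧ v = ψ x + t * lam}, v ≤ sSup S := by
    rintro _ ⟨lam, ψ, hψ, hψφ, hsub, rfl⟩
    refine le_of_forall_pos_sub_le fun ε hε => ?_
    obtain ⟨y, hy, hmin⟩ := hψ.exists_mem_subgradSet x (sub_lt_self (ψ x) hε)
    obtain ⟨hyφ, hlam⟩ := hsub hy
    have hleg : legendreTransform φ y ≤ ⟪x, y⟫ - (ψ x - ε) :=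
      ciSup_le fun z => by linarith [hmin z, hψφ z]
    refine le_trans ?_ (le_csSup hS ⟨y, hyφ, rfl⟩)
    linarith [mul_le_mul_of_nonneg_left hlam ht]
  have hne : S.Nonempty := ⟨_, _, hbij.mapsTo (Set.mem_univ 0), rfl⟩
  have hsub : S ⊆ {v : ℝ | ∃ lam : ℝ, ∃ ψ : EuclideanSpace ℝ (Fin n) → ℝ,
      ConvexOn ℝ Set.univ ψ ∧ (∀ z, ψ z ≤ φ z) ∧
      subgradSet ψ ⊆ {y ∈ subgradSet φ | lam ≤ u y} ∧ v = ψ x + t * lam} := by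
    rintro _ ⟨y, hy, rfl⟩
    refine ⟨u y, fun z => ⟪z, y⟫ - legendreTransform φ y, ⟨convex_univ, ?_⟩, fun z => ?_,
      fun w hw => ?_, rfl⟩
    · intro z _ w _ a b _ _ hab
      refine le_of_eq ?_
      simp only [smul_eq_mul, inner_add_left, real_inner_smul_left]
      linear_combination legendreTransform φ y * hab
    · linarith [inner_sub_le_legendreTransform hy z]
    · obtain rfl : w = y := subgradSet_inner_sub_const y _ hw
      exact ⟨hy, le_rfl⟩
  exact le_antisymm (csSup_le_csSup ⟨_, hle⟩ hne hsub) (csSup_le (hne.mono hsub) hle)
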